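/- Let ℓ, h, s be natural numbers with 1 ≤ s ≤ ℓ and h ≤ ℓ, and let T be a finset of Fin ℓ with |T| = s. Then, as integers, the number of vectors v : Fin ℓ → ZMod 2 with 1 ≤ |supp(v)| ≤ h such that the cardinality of {i ∈ T : v i = 1} is odd equals ∑_{a=1}^{h} ∑_{t=1}^{s} (−2)^{t−1} · C(s, t) · C(ℓ−t, a−t). (This is the Hamming weight of the sum of the s rows of the row block RB₁ of the generating matrix of K(ℓ,h,1) indexed by the degree-one monomials x_i, i ∈ T.) -/

import Mathlib

open Finset

/-- The support of a vector over `ZMod 2`, as a finset. -/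
def suppF {ℓ : ℕ} (v : Fin ℓ → ZMod 2) : Finset (Fin ℓ) :=
  univ.filter fun i => v i ≠ 0

lemma zmod_two_ne_zero_iff (x : ZMod 2) : x ≠ 0 ↔ x = 1 := by
  revert x; decide

lemma mem_suppF {ℓ : ℕ} (v : Fin ℓ → ZMod 2) (i : Fin ℓ) : i ∈ suppF v ↔ v i = 1 := by
  simp [suppF, zmod_two_ne_zero_iff]

lemma suppF_bijective (ℓ : ℕ) :
    Function.Bijective (suppF : (Fin ℓ → ZMod 2) → Finset (Fin ℓ)) := by
  constructor
  · intro v w hvw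
    funext i
    have key : v i = 1 ↔ w i = 1 := by rw [← mem_suppF, ← mem_suppF, hvw]
    generalize v i = x at key
    generalize w i = y at key
    revert x y
    decide
  · intro S
    refine ⟨fun i => if i ∈ S then 1 else 0, ?_⟩
    ext i
    simp [mem_suppF]

/-- The indicator of odd numbers as an alternating sum of binomial coefficients. -/
lemma sum_neg_two_pow_mul_choose {n s : ℕ} (hn : n ≤ s) :
    ∑ t ∈ Icc 1 s, (-2 : ℤ) ^ (t - 1) * (n.choose t : ℤ) = if Odd n then 1 else 0 := by
  have hbinom : ∑ t ∈ range (n + 1), (-2 : ℤ) ^ t * (n.choose t : ℤ) = (-1) ^ n := by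
    simpa using (add_pow (-2 : ℤ) 1 n).symm
  have hext : ∑ t ∈ range (s + 1), (-2 : ℤ) ^ t * (n.choose t : ℤ) = (-1) ^ n := by
    rw [← hbinom]
    refine (sum_subset (range_mono (by omega)) fun t _ ht => ?_).symm
    rw [Nat.choose_eq_zero_of_lt (by simpa using ht)]
    simp
  have hshift : ∑ t ∈ Icc 1 s, (-2 : ℤ) ^ (t - 1) * (n.choose t : ℤ) =
      ∑ t ∈ range s, (-2 : ℤ) ^ t * (n.choose (t + 1) : ℤ) := by
    rw [← Ico_add_one_right_eq_Icc, sum_Ico_eq_sum_range]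
    refine sum_congr (by simp) fun t _ => ?_
    simp [add_comm 1 t]
  rw [sum_range_succ'] at hext
  simp only [pow_succ, mul_right_comm _ (-2 : ℤ), ← sum_mul] at hext
  rw [← hshift] at hext
  split_ifs with hodd
  · rw [hodd.neg_one_pow] at hext
    simp at hext
    omega
  · rw [(Nat.not_odd_iff_even.mp hodd).neg_one_pow] at hext
    simp at hext
    omega

/-- The number of `a`-element subsets containing a given set. -/
lemma card_filter_subset_powersetCard_univ {α : Type*} [Fintype α] [DecidableEq α]
    (U : Finset α) (a : ℕ) :
    #{S ∈ powersetCard a (univ : Finset α) | U ⊆ S} =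
      if #U ≤ a then (Fintype.card α - #U).choose (a - #U) else 0 := by
  split_ifs with hU
  · rw [← card_compl, ← card_powersetCard]
    refine card_nbij' (· \ U) (· ∪ U) ?_ ?_ ?_ ?_
    · intro S hS
      simp only [coe_filter, Set.mem_ofPred_eq, mem_powersetCard, mem_coe] at hS ⊢
      refine ⟨fun x hx => by simp_all, ?_⟩
      rw [card_sdiff_of_subset hS.2, hS.1.2]
    · intro S hS
      simp only [coe_filter, Set.mem_ofPred_eq, mem_powersetCard, mem_coe] at hS ⊢
      refine ⟨⟨subset_univ _, ?_⟩, subset_union_right⟩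
      rw [card_union_of_disjoint (subset_compl_iff_disjoint_right.mp hS.1), hS.2]
      omega
    · intro S hS
      simp only [coe_filter, Set.mem_ofPred_eq] at hS
      exact sdiff_union_of_subset hS.2
    · intro S hS
      simp only [mem_coe, mem_powersetCard] at hS
      exact union_sdiff_cancel_right (subset_compl_iff_disjoint_right.mp hS.1)
  · rw [card_eq_zero, filter_eq_empty_iff]
    intro S hS hUS
    exact hU ((card_le_card hUS).trans_eq (mem_powersetCard.mp hS).2)

/-- Double counting pairs `U ⊆ T ∩ S` with `#U = t` and `#S = a`. -/
lemma sum_powersetCard_choose_card_inter {α : Type*} [Fintype α] [DecidableEq α]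
    (T : Finset α) (a t : ℕ) :
    ∑ S ∈ powersetCard a (univ : Finset α), (#(T ∩ S)).choose t =
      (#T).choose t * if t ≤ a then (Fintype.card α - t).choose (a - t) else 0 := by
  have hchoose (S : Finset α) : (#(T ∩ S)).choose t = #{U ∈ powersetCard t T | U ⊆ S} := by
    rw [← card_powersetCard]
    congr 1
    ext U
    simp only [mem_powersetCard, mem_filter, subset_inter_iff]
    tauto
  simp_rw [hchoose]
  rw [← card_powersetCard t T, ← smul_eq_mul]
  refine (sum_card_bipartiteAbove_eq_sum_card_bipartiteBelow fun S U : Finset α => U ⊆ S).trans ?_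
  refine sum_eq_card_nsmul fun U hU => ?_
  rw [bipartiteBelow, card_filter_subset_powersetCard_univ, (mem_powersetCard.mp hU).2]

theorem weight_of_sum_of_s_rows (ℓ h s : ℕ) (hs1 : 1 ≤ s) (hsl : s ≤ ℓ) (hhl : h ≤ ℓ)
    (T : Finset (Fin ℓ)) (hT : T.card = s) :
    ((univ.filter fun v : Fin ℓ → ZMod 2 =>
        1 ≤ (suppF v).card ∧ (suppF v).card ≤ h ∧
          Odd (T.filter fun i => v i = 1).card).card : ℤ) =
      ∑ a ∈ Icc 1 h, ∑ t ∈ Icc 1 s, (-2 : ℤ) ^ (t - 1) * (s.choose t : ℤ) *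
        (if t ≤ a then ((ℓ - t).choose (a - t) : ℤ) else 0) := by
  have hinter (v : Fin ℓ → ZMod 2) : (T.filter fun i => v i = 1) = T ∩ suppF v := by
    ext i
    simp [mem_suppF]
  have hsets : #{v : Fin ℓ → ZMod 2 | 1 ≤ #(suppF v) ∧ #(suppF v) ≤ h ∧
      Odd #(T.filter fun i => v i = 1)} =
      #{S : Finset (Fin ℓ) | 1 ≤ #S ∧ #S ≤ h ∧ Odd #(T ∩ S)} := by
    refine card_bijective suppF (suppF_bijective ℓ) fun v => ?_
    simp [hinter]
  have hsizes : #{S : Finset (Fin ℓ) | 1 ≤ #S ∧ #S ≤ h ∧ Odd #(T ∩ S)} =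
      ∑ a ∈ Icc 1 h, #{S ∈ powersetCard a (univ : Finset (Fin ℓ)) | Odd #(T ∩ S)} := by
    rw [card_eq_sum_card_fiberwise (f := card) (t := Icc 1 h)]
    · refine sum_congr rfl fun a ha => congrArg card ?_
      ext S
      simp only [mem_filter, mem_univ, true_and, mem_powersetCard_univ, mem_Icc] at ha ⊢
      constructor
      · tauto
      · rintro ⟨rfl, hodd⟩
        exact ⟨⟨ha.1, ha.2, hodd⟩, rfl⟩
    · intro S hS
      simp only [coe_filter, mem_univ, true_and, Set.mem_ofPred_eq] at hS
      simp [hS.1, hS.2.1, -one_le_card]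
  rw [hsets, hsizes, Nat.cast_sum]
  refine sum_congr rfl fun a _ => ?_
  calc (#{S ∈ powersetCard a (univ : Finset (Fin ℓ)) | Odd #(T ∩ S)} : ℤ)
      = ∑ S ∈ powersetCard a univ, ∑ t ∈ Icc 1 s,
          (-2 : ℤ) ^ (t - 1) * ((#(T ∩ S)).choose t : ℤ) := by
        rw [card_filter, Nat.cast_sum]
        refine sum_congr rfl fun S _ => ?_
        rw [sum_neg_two_pow_mul_choose (hT ▸ card_le_card inter_subset_left)]
        push_cast
        rfl
    _ = ∑ t ∈ Icc 1 s, (-2 : ℤ) ^ (t - 1) *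
          ((∑ S ∈ powersetCard a (univ : Finset (Fin ℓ)), (#(T ∩ S)).choose t : ℕ) : ℤ) := by
        rw [sum_comm]
        simp only [Nat.cast_sum, mul_sum]
    _ = _ := by
        refine sum_congr rfl fun t _ => ?_
        rw [sum_powersetCard_choose_card_inter, hT, Fintype.card_fin]
        push_cast
        ring
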